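/- arXiv:1107.3419 — 2 statements merged into one kernel-verified Lean document; each statement's English description precedes it below -/
import Mathlib

section
/- Let α ∈ (1,2) and let L : (0,1) → (0,∞) be measurable, slowly varying at 0+ (i.e. for every a > 0, L(ax)/L(x) → 1 as x → 0+), and such that ∫₀¹ x^{1−α} L(x) dx < ∞. Define Ψ(u) := ∫₀¹ (e^{−xu} − 1 + xu) x^{−1−α} L(x) dx for u ≥ 0. Then for every λ > 0, Ψ(λu)/Ψ(u) → λ^α as u → ∞; that is, Ψ is regularly varying at +∞ with index α. -/
open MeasureTheory Filter

/-- The integrand defining the Laplace exponent `Ψ`. -/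
noncomputable def laplaceIntegrand (α : ℝ) (L : ℝ → ℝ) (u x : ℝ) : ℝ :=
  (Real.exp (-(x * u)) - 1 + x * u) * (x ^ (-1 - α) * L x)

lemma exp_neg_sub_one_add_nonneg (y : ℝ) : 0 ≤ Real.exp (-y) - 1 + y := by
  linarith [Real.add_one_le_exp (-y)]

lemma exp_neg_sub_one_add_le_self {y : ℝ} (hy : 0 ≤ y) : Real.exp (-y) - 1 + y ≤ y := by
  have : Real.exp (-y) ≤ 1 := Real.exp_le_one_iff.2 (by linarith)
  linarith

lemma exp_neg_sub_one_add_le_sq {y : ℝ} (hy : 0 ≤ y) : Real.exp (-y) - 1 + y ≤ y ^ 2 := by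
  rcases le_total y 1 with h | h
  · have := (abs_le.1 (Real.abs_exp_sub_one_sub_id_le (x := -y)
      (by rw [abs_neg, abs_of_nonneg hy]; exact h))).2
    linarith [neg_sq y]
  · nlinarith [exp_neg_sub_one_add_le_self hy]

lemma half_le_exp_neg_sub_one_add {y : ℝ} (hy : 2 ≤ y) :
    y / 2 ≤ Real.exp (-y) - 1 + y := by
  linarith [Real.exp_pos (-y)]

section

variable {α : ℝ} {L : ℝ → ℝ}

lemma laplaceIntegrand_nonneg (hLpos : ∀ x ∈ Set.Ioo (0 : ℝ) 1, 0 < L x) (u : ℝ) {x : ℝ}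
    (hx : x ∈ Set.Ioo (0 : ℝ) 1) : 0 ≤ laplaceIntegrand α L u x :=
  mul_nonneg (exp_neg_sub_one_add_nonneg _)
    (mul_nonneg (Real.rpow_nonneg hx.1.le _) (hLpos x hx).le)

lemma rpow_one_sub_eq {x : ℝ} (hx : 0 < x) : x ^ (1 - α) = x ^ 2 * x ^ (-1 - α) := by
  rw [← Real.rpow_natCast, ← Real.rpow_add hx]
  congr 1
  push_cast
  ring

lemma rpow_neg_eq {x : ℝ} (hx : 0 < x) : x ^ (-α) = x * x ^ (-1 - α) := by
  nth_rewrite 2 [← Real.rpow_one x]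
  rw [← Real.rpow_add hx]
  congr 1
  ring

lemma laplaceIntegrand_le_sq (hLpos : ∀ x ∈ Set.Ioo (0 : ℝ) 1, 0 < L x) {u : ℝ} (hu : 0 ≤ u)
    {x : ℝ} (hx : x ∈ Set.Ioo (0 : ℝ) 1) :
    laplaceIntegrand α L u x ≤ u ^ 2 * (x ^ (1 - α) * L x) := by
  have hw := mul_nonneg (Real.rpow_nonneg hx.1.le (-1 - α)) (hLpos x hx).le
  have := mul_le_mul_of_nonneg_right (exp_neg_sub_one_add_le_sq (mul_nonneg hx.1.le hu)) hw
  rw [rpow_one_sub_eq hx.1]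
  unfold laplaceIntegrand
  linarith

lemma laplaceIntegrand_le_linear (hLpos : ∀ x ∈ Set.Ioo (0 : ℝ) 1, 0 < L x) {u : ℝ}
    (hu : 0 ≤ u) {x η : ℝ} (hη : 0 < η) (hηx : η ≤ x) (hx : x ∈ Set.Ioo (0 : ℝ) 1) :
    laplaceIntegrand α L u x ≤ u / η * (x ^ (1 - α) * L x) := by
  have hw := mul_nonneg (Real.rpow_nonneg hx.1.le (-1 - α)) (hLpos x hx).le
  have hle : x * u ≤ u / η * x ^ 2 := by
    have h1 : 1 ≤ x / η := (one_le_div hη).2 hηx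
    calc x * u ≤ x * u * (x / η) := le_mul_of_one_le_right (mul_nonneg hx.1.le hu) h1
      _ = u / η * x ^ 2 := by ring
  have := mul_le_mul_of_nonneg_right
    ((exp_neg_sub_one_add_le_self (mul_nonneg hx.1.le hu)).trans hle) hw
  rw [rpow_one_sub_eq hx.1]
  unfold laplaceIntegrand
  linarith

lemma linear_le_laplaceIntegrand (hLpos : ∀ x ∈ Set.Ioo (0 : ℝ) 1, 0 < L x) {u x : ℝ}
    (hux : 2 ≤ x * u) (hx : x ∈ Set.Ioo (0 : ℝ) 1) :
    u / 2 * (x ^ (-α) * L x) ≤ laplaceIntegrand α L u x := by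
  have hw := mul_nonneg (Real.rpow_nonneg hx.1.le (-1 - α)) (hLpos x hx).le
  have := mul_le_mul_of_nonneg_right (half_le_exp_neg_sub_one_add hux) hw
  rw [rpow_neg_eq hx.1]
  unfold laplaceIntegrand
  linarith

lemma measurable_laplaceIntegrand (hLmeas : Measurable L) (u : ℝ) :
    Measurable (laplaceIntegrand α L u) := by
  unfold laplaceIntegrand
  fun_prop

lemma intervalIntegrable_laplaceIntegrand (hLmeas : Measurable L)
    (hLpos : ∀ x ∈ Set.Ioo (0 : ℝ) 1, 0 < L x)
    (hLint : IntegrableOn (fun x => x ^ (1 - α) * L x) (Set.Ioo (0 : ℝ) 1))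
    {u : ℝ} (hu : 0 ≤ u) {a b : ℝ} (ha : a ∈ Set.Icc (0 : ℝ) 1) (hb : b ∈ Set.Icc (0 : ℝ) 1) :
    IntervalIntegrable (laplaceIntegrand α L u) volume a b := by
  have h01 : IntervalIntegrable (laplaceIntegrand α L u) volume 0 1 := by
    rw [intervalIntegrable_iff_integrableOn_Ioo_of_le zero_le_one]
    refine (hLint.const_mul (u ^ 2)).mono'
      (measurable_laplaceIntegrand hLmeas u).aestronglyMeasurable ?_
    filter_upwards [ae_restrict_mem measurableSet_Ioo] with x hx
    rw [Real.norm_of_nonneg (laplaceIntegrand_nonneg hLpos u hx)]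
    exact laplaceIntegrand_le_sq hLpos hu hx
  refine h01.mono_set ?_
  rw [Set.uIcc_of_le zero_le_one]
  exact Set.uIcc_subset_Icc ha hb

/-- The part of the integral away from zero grows at most linearly. -/
lemma integral_laplaceIntegrand_tail_mem (hLmeas : Measurable L)
    (hLpos : ∀ x ∈ Set.Ioo (0 : ℝ) 1, 0 < L x)
    (hLint : IntegrableOn (fun x => x ^ (1 - α) * L x) (Set.Ioo (0 : ℝ) 1))
    {u η : ℝ} (hu : 0 ≤ u) (hη : η ∈ Set.Ioo (0 : ℝ) 1) :
    (∫ x in η..1, laplaceIntegrand α L u x) ∈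
      Set.Icc 0 (u * (η⁻¹ * ∫ x in η..1, x ^ (1 - α) * L x)) := by
  have hsub : ∀ x ∈ Set.Ioo η 1, x ∈ Set.Ioo (0 : ℝ) 1 := fun x hx => ⟨hη.1.trans hx.1, hx.2⟩
  have hG := intervalIntegrable_laplaceIntegrand hLmeas hLpos hLint hu (a := η) (b := 1)
    ⟨hη.1.le, hη.2.le⟩ ⟨zero_le_one, le_rfl⟩
  have hm : IntervalIntegrable (fun x => x ^ (1 - α) * L x) volume η 1 := by
    rw [intervalIntegrable_iff_integrableOn_Ioo_of_le hη.2.le]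
    exact hLint.mono_set hsub
  constructor
  · have := intervalIntegral.integral_mono_on_of_le_Ioo hη.2.le
      (intervalIntegrable_const (c := (0 : ℝ))) hG
      (fun x hx => laplaceIntegrand_nonneg hLpos u (hsub x hx))
    simpa using this
  · have := intervalIntegral.integral_mono_on_of_le_Ioo hη.2.le hG (hm.const_mul (u / η))
      (fun x hx => laplaceIntegrand_le_linear hLpos hu hη.1 hx.1.le (hsub x hx))
    rw [intervalIntegral.integral_const_mul] at this
    rwa [← mul_assoc, ← div_eq_mul_inv]

lemma intervalIntegrable_rpow_neg_mul (hLmeas : Measurable L)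
    (hLpos : ∀ x ∈ Set.Ioo (0 : ℝ) 1, 0 < L x)
    (hLint : IntegrableOn (fun x => x ^ (1 - α) * L x) (Set.Ioo (0 : ℝ) 1))
    {η : ℝ} (hη : η ∈ Set.Ioo (0 : ℝ) 1) :
    IntervalIntegrable (fun x => x ^ (-α) * L x) volume η 1 := by
  have hsub : ∀ x ∈ Set.Ioo η 1, x ∈ Set.Ioo (0 : ℝ) 1 := fun x hx => ⟨hη.1.trans hx.1, hx.2⟩
  rw [intervalIntegrable_iff_integrableOn_Ioo_of_le hη.2.le]
  refine ((hLint.mono_set hsub).const_mul η⁻¹).mono'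
    (Measurable.aestronglyMeasurable (by fun_prop)) ?_
  filter_upwards [ae_restrict_mem measurableSet_Ioo] with x hx
  have hx0 := hsub x hx
  have hw := mul_nonneg (Real.rpow_nonneg hx0.1.le (-1 - α)) (hLpos x hx0).le
  rw [Real.norm_of_nonneg (mul_nonneg (Real.rpow_nonneg hx0.1.le _) (hLpos x hx0).le),
    rpow_neg_eq hx0.1, rpow_one_sub_eq hx0.1]
  have h1 : 1 ≤ η⁻¹ * x := by
    rw [mul_comm, ← div_eq_mul_inv]
    exact (one_le_div hη.1).2 hx.1.le
  have := le_mul_of_one_le_right (mul_nonneg hx0.1.le hw) h1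
  linarith

/-- If `1 < α` and `L` is slowly varying at zero, then `x ^ (-α) * L x` is not integrable
at zero. -/
lemma not_intervalIntegrable_rpow_neg_mul (hα : 1 < α)
    (hLpos : ∀ x ∈ Set.Ioo (0 : ℝ) 1, 0 < L x)
    (hLslow : Tendsto (fun x => L (2⁻¹ * x) / L x) (nhdsWithin 0 (Set.Ioi 0)) (nhds 1)) :
    ¬ IntervalIntegrable (fun x => x ^ (-α) * L x) volume 0 1 := by
  intro hint
  have hc : (2 : ℝ) ^ (1 - α) < 1 := Real.rpow_lt_one_of_one_lt_of_neg one_lt_two (by linarith)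
  obtain ⟨δ₀, hδ₀, hδ₀L⟩ := mem_nhdsGT_iff_exists_Ioo_subset.1 (hLslow.eventually_const_lt hc)
  obtain ⟨δ, hδ, hδ'⟩ := exists_between (lt_min (Set.mem_Ioi.1 hδ₀) one_pos)
  obtain ⟨hδδ₀, hδ1⟩ := lt_min_iff.1 hδ'
  have hsub : ∀ {a b : ℝ}, a ∈ Set.Icc (0 : ℝ) 1 → b ∈ Set.Icc (0 : ℝ) 1 →
      IntervalIntegrable (fun x => x ^ (-α) * L x) volume a b := by
    intro a b ha hb
    refine hint.mono_set ?_
    rw [Set.uIcc_of_le zero_le_one]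
    exact Set.uIcc_subset_Icc ha hb
  have h0 : (0 : ℝ) ∈ Set.Icc (0 : ℝ) 1 := ⟨le_rfl, zero_le_one⟩
  have hd : δ ∈ Set.Icc (0 : ℝ) 1 := ⟨hδ.le, hδ1.le⟩
  have hd2 : 2⁻¹ * δ ∈ Set.Icc (0 : ℝ) 1 := ⟨by linarith, by linarith⟩
  have hpos : 0 < ∫ x in (2⁻¹ * δ)..δ, x ^ (-α) * L x := by
    refine intervalIntegral.intervalIntegral_pos_of_pos_on (hsub hd2 hd) (fun x hx => ?_)
      (by linarith)
    have hx0 : 0 < x := by linarith [hx.1]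
    exact mul_pos (Real.rpow_pos_of_pos hx0 _) (hLpos x ⟨hx0, hx.2.trans hδ1⟩)
  have hadd := intervalIntegral.integral_add_adjacent_intervals (hsub h0 hd2) (hsub hd2 hd)
  have hscale := intervalIntegral.integral_comp_mul_left (a := 0) (b := δ)
    (fun x => x ^ (-α) * L x) (c := 2⁻¹) (by norm_num)
  have hcomp : IntervalIntegrable (fun x => (2⁻¹ * x) ^ (-α) * L (2⁻¹ * x)) volume 0 δ := by
    have := (hsub h0 hd2).comp_mul_left (c := 2⁻¹)
    rwa [zero_div, show 2⁻¹ * δ / 2⁻¹ = δ by ring] at this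
  have hmono := intervalIntegral.integral_mono_on_of_le_Ioo hδ.le
    ((hsub h0 hd).const_mul 2) hcomp (fun x hx => ?_)
  · rw [intervalIntegral.integral_const_mul, hscale, mul_zero, inv_inv, smul_eq_mul] at hmono
    linarith
  · have hLx := hLpos x ⟨hx.1, hx.2.trans hδ1⟩
    have hratio : 2 ^ (1 - α) < L (2⁻¹ * x) / L x := hδ₀L ⟨hx.1, hx.2.trans hδδ₀⟩
    rw [lt_div_iff₀ hLx] at hratio
    have h2 : (2⁻¹ * x) ^ (-α) = 2 ^ α * x ^ (-α) := by
      rw [Real.mul_rpow (by norm_num) hx.1.le, Real.inv_rpow (by norm_num),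
        Real.rpow_neg (by norm_num), inv_inv]
    have h3 : (2 : ℝ) ^ α * 2 ^ (1 - α) = 2 := by
      rw [← Real.rpow_add two_pos]
      norm_num
    have hp : 0 < (2 : ℝ) ^ α * x ^ (-α) :=
      mul_pos (Real.rpow_pos_of_pos two_pos _) (Real.rpow_pos_of_pos hx.1 _)
    calc 2 * (x ^ (-α) * L x) = 2 ^ α * x ^ (-α) * (2 ^ (1 - α) * L x) := by
          nth_rewrite 1 [← h3]
          ring
      _ ≤ (2⁻¹ * x) ^ (-α) * L (2⁻¹ * x) := by
          rw [h2]
          exact mul_le_mul_of_nonneg_left hratio.le hp.le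

/-- The Laplace exponent grows faster than linearly. -/
lemma eventually_mul_le_integral_laplaceIntegrand (hα : 1 < α) (hLmeas : Measurable L)
    (hLpos : ∀ x ∈ Set.Ioo (0 : ℝ) 1, 0 < L x)
    (hLslow : Tendsto (fun x => L (2⁻¹ * x) / L x) (nhdsWithin 0 (Set.Ioi 0)) (nhds 1))
    (hLint : IntegrableOn (fun x => x ^ (1 - α) * L x) (Set.Ioo (0 : ℝ) 1)) (K : ℝ) :
    ∀ᶠ u in atTop, K * u ≤ ∫ x in (0 : ℝ)..1, laplaceIntegrand α L u x := by
  have hη : ∃ η ∈ Set.Ioo (0 : ℝ) 1, 2 * K ≤ ∫ x in η..1, x ^ (-α) * L x := by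
    by_contra! hbdd
    refine not_intervalIntegrable_rpow_neg_mul hα hLpos hLslow ?_
    rw [intervalIntegrable_iff_integrableOn_Ioc_of_le zero_le_one]
    have hmem : ∀ n : ℕ, 1 / ((n : ℝ) + 2) ∈ Set.Ioo (0 : ℝ) 1 := fun n =>
      ⟨by positivity, by rw [div_lt_one (by positivity)]; linarith [n.cast_nonneg (α := ℝ)]⟩
    have hlim : Tendsto (fun n : ℕ => 1 / ((n : ℝ) + 2)) atTop (nhds 0) :=
      tendsto_const_nhds.div_atTop (tendsto_atTop_add_const_right _ _ tendsto_natCast_atTop_atTop)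
    refine integrableOn_Ioc_of_intervalIntegral_norm_bounded_left (I := 2 * K) (fun n =>
      (intervalIntegrable_iff_integrableOn_Ioc_of_le (hmem n).2.le).1
        (intervalIntegrable_rpow_neg_mul hLmeas hLpos hLint (hmem n))) hlim
      (Eventually.of_forall fun n => ?_)
    refine le_trans (le_of_eq ?_) (hbdd _ (hmem n)).le
    rw [intervalIntegral.integral_of_le (hmem n).2.le, integral_Ioc_eq_integral_Ioo,
      integral_Ioc_eq_integral_Ioo]
    refine setIntegral_congr_fun measurableSet_Ioo fun x hx => ?_
    have hx0 : 0 < x := (hmem n).1.trans hx.1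
    exact Real.norm_of_nonneg
      (mul_nonneg (Real.rpow_nonneg hx0.le _) (hLpos x ⟨hx0, hx.2⟩).le)
  obtain ⟨η, hη, hK⟩ := hη
  filter_upwards [eventually_ge_atTop (2 / η)] with u hu
  have hu0 : 0 < u := (div_pos two_pos hη.1).trans_le hu
  have hIη : η ∈ Set.Icc (0 : ℝ) 1 := ⟨hη.1.le, hη.2.le⟩
  have hI0 : (0 : ℝ) ∈ Set.Icc (0 : ℝ) 1 := ⟨le_rfl, zero_le_one⟩
  have hI1 : (1 : ℝ) ∈ Set.Icc (0 : ℝ) 1 := ⟨zero_le_one, le_rfl⟩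
  have hG {a b : ℝ} := intervalIntegrable_laplaceIntegrand hLmeas hLpos hLint hu0.le
    (a := a) (b := b)
  rw [← intervalIntegral.integral_add_adjacent_intervals (hG hI0 hIη) (hG hIη hI1)]
  have hnear := intervalIntegral.integral_mono_on_of_le_Ioo hη.1.le
    (intervalIntegrable_const (c := (0 : ℝ))) (hG hI0 hIη)
    (fun x hx => laplaceIntegrand_nonneg hLpos u ⟨hx.1, hx.2.trans hη.2⟩)
  have hfar := intervalIntegral.integral_mono_on_of_le_Ioo hη.2.le
    ((intervalIntegrable_rpow_neg_mul hLmeas hLpos hLint hη).const_mul (u / 2)) (hG hIη hI1)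
    (fun x hx => by
      refine linear_le_laplaceIntegrand hLpos ?_ ⟨hη.1.trans hx.1, hx.2⟩
      rw [div_le_iff₀ hη.1] at hu
      nlinarith [hx.1])
  rw [intervalIntegral.integral_const_mul] at hfar
  rw [intervalIntegral.integral_zero] at hnear
  nlinarith

/-- Near zero, scaling the argument of the Laplace exponent by `lam` multiplies it by
`lam ^ α`, up to the relative oscillation of `L`. -/
lemma abs_integral_laplaceIntegrand_scale_sub_le (hLmeas : Measurable L)
    (hLpos : ∀ x ∈ Set.Ioo (0 : ℝ) 1, 0 < L x)
    (hLint : IntegrableOn (fun x => x ^ (1 - α) * L x) (Set.Ioo (0 : ℝ) 1))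
    {lam δ ε u : ℝ} (hlam : 0 < lam) (hδ : δ ∈ Set.Ioo (0 : ℝ) 1) (hu : 0 ≤ u)
    (hL : ∀ x ∈ Set.Ioo 0 δ, |L (lam⁻¹ * x) / L x - 1| ≤ ε) :
    |(∫ x in (0 : ℝ)..(lam⁻¹ * δ), laplaceIntegrand α L (lam * u) x) -
        lam ^ α * ∫ x in (0 : ℝ)..δ, laplaceIntegrand α L u x| ≤
      lam ^ α * (ε * ∫ x in (0 : ℝ)..δ, laplaceIntegrand α L u x) := by
  set D : ℝ → ℝ := fun x =>
    (Real.exp (-(x * u)) - 1 + x * u) * (x ^ (-1 - α) * (L (lam⁻¹ * x) - L x)) with hD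
  have hG := intervalIntegrable_laplaceIntegrand hLmeas hLpos hLint hu (a := 0) (b := δ)
    ⟨le_rfl, zero_le_one⟩ ⟨hδ.1.le, hδ.2.le⟩
  have hDle : ∀ x ∈ Set.Ioo 0 δ, ‖D x‖ ≤ ε * laplaceIntegrand α L u x := by
    intro x hx
    have hLx := hLpos x ⟨hx.1, hx.2.trans hδ.2⟩
    have hosc : |L (lam⁻¹ * x) - L x| ≤ ε * L x := by
      have h := hL x hx
      rwa [div_sub_one hLx.ne', abs_div, abs_of_pos hLx, div_le_iff₀ hLx] at h
    rw [hD, Real.norm_eq_abs, abs_mul, abs_mul, abs_of_nonneg (exp_neg_sub_one_add_nonneg _),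
      abs_of_nonneg (Real.rpow_nonneg hx.1.le _)]
    have := mul_le_mul_of_nonneg_left hosc (mul_nonneg (exp_neg_sub_one_add_nonneg (x * u))
      (Real.rpow_nonneg hx.1.le (-1 - α)))
    unfold laplaceIntegrand
    linarith
  have hDint : IntervalIntegrable D volume 0 δ := by
    rw [intervalIntegrable_iff_integrableOn_Ioo_of_le hδ.1.le] at hG ⊢
    refine (hG.const_mul ε).mono' (Measurable.aestronglyMeasurable (by fun_prop)) ?_
    filter_upwards [ae_restrict_mem measurableSet_Ioo] with x hx using hDle x hx
  have hDnorm : |∫ x in (0 : ℝ)..δ, D x| ≤ ε * ∫ x in (0 : ℝ)..δ, laplaceIntegrand α L u x := by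
    rw [← intervalIntegral.integral_const_mul, ← Real.norm_eq_abs]
    refine intervalIntegral.norm_integral_le_of_norm_le hδ.1.le ?_ (hG.const_mul ε)
    filter_upwards [compl_mem_ae_iff.2 (measure_singleton (μ := volume) δ)] with x hxδ hx
    exact hDle x ⟨hx.1, lt_of_le_of_ne hx.2 hxδ⟩
  have hscale : ∫ x in (0 : ℝ)..(lam⁻¹ * δ), laplaceIntegrand α L (lam * u) x =
      lam ^ α * ∫ x in (0 : ℝ)..δ, (D x + laplaceIntegrand α L u x) := by
    have h := intervalIntegral.integral_comp_mul_left (a := 0) (b := δ)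
      (laplaceIntegrand α L (lam * u)) (inv_pos.2 hlam).ne'
    rw [mul_zero, inv_inv, smul_eq_mul] at h
    have hcongr : ∫ x in (0 : ℝ)..δ, laplaceIntegrand α L (lam * u) (lam⁻¹ * x) =
        lam ^ (1 + α) * ∫ x in (0 : ℝ)..δ, (D x + laplaceIntegrand α L u x) := by
      rw [← intervalIntegral.integral_const_mul]
      refine intervalIntegral.integral_congr fun x hx => ?_
      rw [Set.uIcc_of_le hδ.1.le] at hx
      have h1 : lam⁻¹ * x * (lam * u) = x * u := by field_simp
      have h2 : (lam⁻¹ * x) ^ (-1 - α) = lam ^ (1 + α) * x ^ (-1 - α) := by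
        rw [Real.mul_rpow (inv_pos.2 hlam).le hx.1, Real.inv_rpow hlam.le,
          ← Real.rpow_neg hlam.le]
        congr 2
        ring
      simp only [hD, laplaceIntegrand, h1, h2]
      ring
    rw [hcongr, Real.rpow_add hlam, Real.rpow_one, mul_assoc] at h
    exact (mul_left_cancel₀ hlam.ne' h).symm
  rw [hscale, intervalIntegral.integral_add hDint hG, ← mul_sub, add_sub_cancel_right, abs_mul,
    abs_of_pos (Real.rpow_pos_of_pos hlam α)]
  exact mul_le_mul_of_nonneg_left hDnorm (Real.rpow_pos_of_pos hlam α).le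

end


/-- if `Λ(du) = u^{1-α} L(u) du` with `α ∈ (1,2)` and `L`
slowly varying at `0+`, then `Ψ(u) = ∫₀¹ (e^{-xu} - 1 + xu) x^{-1-α} L(x) dx`
is regularly varying at `+∞` with index `α`. -/
theorem stmt7 (α : ℝ) (hα : α ∈ Set.Ioo (1 : ℝ) 2) (L : ℝ → ℝ)
    (hLmeas : Measurable L)
    (hLpos : ∀ x ∈ Set.Ioo (0 : ℝ) 1, 0 < L x)
    (hLslow : ∀ a : ℝ, 0 < a →
      Tendsto (fun x => L (a * x) / L x) (nhdsWithin 0 (Set.Ioi 0)) (nhds 1))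
    (hLint : IntegrableOn (fun x => x ^ (1 - α) * L x) (Set.Ioo (0 : ℝ) 1))
    (Ψ : ℝ → ℝ)
    (hΨ : ∀ u : ℝ, Ψ u =
      ∫ x in Set.Ioo (0 : ℝ) 1, (Real.exp (-(x * u)) - 1 + x * u) * (x ^ (-1 - α) * L x)) :
    ∀ lam : ℝ, 0 < lam →
      Tendsto (fun u : ℝ => Ψ (lam * u) / Ψ u) atTop (nhds (lam ^ α)) := by
  intro lam hlam
  have hΨ' : ∀ u, Ψ u = ∫ x in (0 : ℝ)..1, laplaceIntegrand α L u x := by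
    intro u
    rw [hΨ, intervalIntegral.integral_of_le zero_le_one, integral_Ioc_eq_integral_Ioo]
    rfl
  have hlamα : 0 < lam ^ α := Real.rpow_pos_of_pos hlam α
  have hI0 : (0 : ℝ) ∈ Set.Icc (0 : ℝ) 1 := ⟨le_rfl, zero_le_one⟩
  have hI1 : (1 : ℝ) ∈ Set.Icc (0 : ℝ) 1 := ⟨zero_le_one, le_rfl⟩
  rw [Metric.tendsto_nhds]
  intro r hr
  obtain ⟨ε, hε, hεr⟩ : ∃ ε > 0, lam ^ α * ε = r / 4 :=
    ⟨r / 4 / lam ^ α, by positivity, by field_simp⟩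
  obtain ⟨δ₀, hδ₀, hδ₀L⟩ := mem_nhdsGT_iff_exists_Ioo_subset.1
    (Metric.tendsto_nhds.1 (hLslow lam⁻¹ (inv_pos.2 hlam)) ε hε)
  obtain ⟨δ, hδ, hδ'⟩ := exists_between (lt_min (lt_min (Set.mem_Ioi.1 hδ₀) one_pos) hlam)
  obtain ⟨hδ'', hδlam⟩ := lt_min_iff.1 hδ'
  obtain ⟨hδδ₀, hδ1⟩ := lt_min_iff.1 hδ''
  have hη : lam⁻¹ * δ ∈ Set.Ioo (0 : ℝ) 1 :=
    ⟨mul_pos (inv_pos.2 hlam) hδ, (inv_mul_lt_one₀ hlam).2 hδlam⟩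
  set C₁ := δ⁻¹ * ∫ x in δ..1, x ^ (1 - α) * L x
  set C₂ := (lam⁻¹ * δ)⁻¹ * ∫ x in (lam⁻¹ * δ)..1, x ^ (1 - α) * L x
  filter_upwards [eventually_gt_atTop 0, eventually_mul_le_integral_laplaceIntegrand hα.1 hLmeas
    hLpos (hLslow 2⁻¹ (by norm_num)) hLint 1, eventually_mul_le_integral_laplaceIntegrand hα.1
    hLmeas hLpos (hLslow 2⁻¹ (by norm_num)) hLint ((lam ^ α * C₁ + lam * C₂) / (r / 4))]
    with u hu hΨu hΨC
  rw [← hΨ'] at hΨu hΨC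
  have hΨpos : 0 < Ψ u := by linarith
  rw [div_mul_eq_mul_div, div_le_iff₀ (by positivity)] at hΨC
  have hlu : 0 ≤ lam * u := (mul_pos hlam hu).le
  have hsplit₁ := intervalIntegral.integral_add_adjacent_intervals
    (intervalIntegrable_laplaceIntegrand hLmeas hLpos hLint hu.le hI0 ⟨hδ.le, hδ1.le⟩)
    (intervalIntegrable_laplaceIntegrand hLmeas hLpos hLint hu.le ⟨hδ.le, hδ1.le⟩ hI1)
  have hsplit₂ := intervalIntegral.integral_add_adjacent_intervals
    (intervalIntegrable_laplaceIntegrand hLmeas hLpos hLint hlu hI0 ⟨hη.1.le, hη.2.le⟩)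
    (intervalIntegrable_laplaceIntegrand hLmeas hLpos hLint hlu ⟨hη.1.le, hη.2.le⟩ hI1)
  rw [← hΨ'] at hsplit₁ hsplit₂
  have htail₁ := integral_laplaceIntegrand_tail_mem hLmeas hLpos hLint hu.le ⟨hδ, hδ1⟩
  have htail₂ := integral_laplaceIntegrand_tail_mem hLmeas hLpos hLint hlu hη
  have hmain := abs_integral_laplaceIntegrand_scale_sub_le hLmeas hLpos hLint hlam ⟨hδ, hδ1⟩
    hu.le (ε := ε) (fun x hx => by
      have : dist (L (lam⁻¹ * x) / L x) 1 < ε := hδ₀L ⟨hx.1, hx.2.trans hδδ₀⟩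
      exact this.le)
  set A := ∫ x in (0 : ℝ)..δ, laplaceIntegrand α L u x
  set a := ∫ x in δ..1, laplaceIntegrand α L u x
  set B := ∫ x in (0 : ℝ)..(lam⁻¹ * δ), laplaceIntegrand α L (lam * u) x
  set b := ∫ x in (lam⁻¹ * δ)..1, laplaceIntegrand α L (lam * u) x
  have hA : A ≤ Ψ u := by linarith [htail₁.1]
  rw [← mul_assoc, hεr] at hmain
  have hmain' := hmain.trans (mul_le_mul_of_nonneg_left hA (by positivity))
  have ha0 : 0 ≤ lam ^ α * a := mul_nonneg hlamα.le htail₁.1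
  have ha := mul_le_mul_of_nonneg_left htail₁.2 hlamα.le
  have hb0 := htail₂.1
  have hb : b ≤ lam * u * C₂ := htail₂.2
  have hC₁ : 0 ≤ lam ^ α * (u * C₁) := ha0.trans ha
  have hC₂ : 0 ≤ lam * u * C₂ := hb0.trans hb
  have hrΨ : 0 < r * Ψ u := mul_pos hr hΨpos
  rw [Real.dist_eq, div_sub' hΨpos.ne', abs_div, abs_of_pos hΨpos, div_lt_iff₀ hΨpos, abs_lt]
  obtain ⟨hlo, hhi⟩ := abs_le.1 hmain'
  rw [← hsplit₂]
  have hexp : Ψ u * lam ^ α = lam ^ α * A + lam ^ α * a := by rw [← hsplit₁]; ring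
  rw [hexp]
  constructor <;> linarith
end

section
/- Let a > 1, ε > 0 and an integer n₀ ≥ 3 satisfy ε + 2/n₀ < 1, and a·n₀ ≥ n₀ + 1; set u' := 1 − a^{−1}(1 − ε − 2/n₀) ∈ (0,1). Then for every integer n ≥ n₀ and every u ∈ (u', 1), a binomial random variable Q with ⌊an⌋ − 3 trials and success probability 1 − u satisfies P(Q > n − 2) ≤ a/(4 ε² n). -/
/-- The variance of a binomial random variable with `N` trials and success probability `q`. -/
theorem sum_sub_sq_mul_choose_mul_pow (N : ℕ) (q : ℝ) :
    ∑ k ∈ Finset.range (N + 1), ((N : ℝ) * q - k) ^ 2 *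
        ((N.choose k : ℝ) * q ^ k * (1 - q) ^ (N - k)) = N * q * (1 - q) := by
  have h := congrArg (Polynomial.eval q) (bernsteinPolynomial.variance ℝ N)
  simpa [Polynomial.eval_finsetSum, bernsteinPolynomial] using h

/-- Chebyshev's inequality for the upper tail of a binomial random variable. -/
theorem binomial_upper_tail_le {N m : ℕ} {q t : ℝ} (hq₀ : 0 ≤ q) (hq₁ : q ≤ 1) (ht : 0 < t)
    (hm : ∀ k : ℕ, m < k → (N : ℝ) * q + t ≤ k) :
    ∑ k ∈ Finset.Ioc m N, (N.choose k : ℝ) * q ^ k * (1 - q) ^ (N - k) ≤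
      N * q * (1 - q) / t ^ 2 := by
  have hq : 0 ≤ 1 - q := sub_nonneg.2 hq₁
  rw [le_div_iff₀ (by positivity), ← sum_sub_sq_mul_choose_mul_pow N q, Finset.sum_mul]
  calc
    _ ≤ ∑ k ∈ Finset.Ioc m N, ((N : ℝ) * q - k) ^ 2 *
        ((N.choose k : ℝ) * q ^ k * (1 - q) ^ (N - k)) := by
      refine Finset.sum_le_sum fun k hk => ?_
      rw [mul_comm]
      have hk' := hm k (Finset.mem_Ioc.1 hk).1
      have : t ^ 2 ≤ ((N : ℝ) * q - k) ^ 2 := by nlinarith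
      exact mul_le_mul_of_nonneg_right this (by positivity)
    _ ≤ _ := by
      refine Finset.sum_le_sum_of_subset_of_nonneg (fun k hk => ?_) fun k _ _ => by positivity
      have := (Finset.mem_Ioc.1 hk).2
      exact Finset.mem_range.2 (by omega)

/-- Chebyshev-type bound for a binomial random variable.
Let `a > 1`, `ε > 0` and an integer `n₀ ≥ 3` with `ε + 2/n₀ < 1` and
`a n₀ ≥ n₀ + 1`, and set `u' := 1 - a⁻¹ (1 - ε - 2/n₀)`.  Then for every
`n ≥ n₀` and every `u ∈ (u', 1)`, a binomial random variable `Q` with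
`⌊an⌋ - 3` trials and success probability `1 - u` satisfies
`P(Q > n - 2) ≤ a / (4 ε² n)`, where
`P(Q > n-2) = ∑_{k=n-1}^{N} C(N,k) (1-u)^k u^{N-k}` with `N = ⌊an⌋ - 3`. -/
theorem stmt16 (a ε : ℝ) (n₀ : ℕ) (ha : 1 < a) (hε : 0 < ε) (hn₀ : 3 ≤ n₀)
    (h1 : ε + 2 / (n₀ : ℝ) < 1) (h2 : (n₀ : ℝ) + 1 ≤ a * (n₀ : ℝ)) :
    ∀ n : ℕ, n₀ ≤ n → ∀ u : ℝ, 1 - a⁻¹ * (1 - ε - 2 / (n₀ : ℝ)) < u → u < 1 →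
      ∑ k ∈ Finset.Ioc (n - 2) (⌊a * (n : ℝ)⌋₊ - 3),
          ((⌊a * (n : ℝ)⌋₊ - 3).choose k : ℝ) * (1 - u) ^ k *
            u ^ ((⌊a * (n : ℝ)⌋₊ - 3) - k) ≤
        a / (4 * ε ^ 2 * (n : ℝ)) := by
  intro n hn u hu hu1
  have hn0 : (0 : ℝ) < n₀ := by exact_mod_cast (by omega : 0 < n₀)
  have hnn : (n₀ : ℝ) ≤ n := by exact_mod_cast hn
  have hnpos : (0 : ℝ) < n := hn0.trans_le hnn
  have ha0 : 0 < a := by linarith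
  have haq : a * (1 - u) < 1 - ε - 2 / n₀ := by
    have := mul_lt_mul_of_pos_left (show 1 - u < a⁻¹ * (1 - ε - 2 / n₀) by linarith) ha0
    rwa [mul_inv_cancel_left₀ ha0.ne'] at this
  have hu0 : 0 ≤ u := by
    have : 0 < 2 / (n₀ : ℝ) := by positivity
    nlinarith
  have h2n : 2 ≤ 2 / (n₀ : ℝ) * n := by
    rw [div_mul_eq_mul_div, le_div_iff₀ hn0]
    linarith
  set N := ⌊a * (n : ℝ)⌋₊ - 3
  have hN : (N : ℝ) ≤ a * n :=
    (Nat.cast_le.2 (Nat.sub_le _ _)).trans (Nat.floor_le (by positivity))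
  have hmean : (N : ℝ) * (1 - u) + ε * n ≤ n - 2 := by
    have := mul_le_mul_of_nonneg_right hN (sub_nonneg.2 hu1.le)
    have := mul_le_mul_of_nonneg_right haq.le hnpos.le
    linarith
  have htail := binomial_upper_tail_le (N := N) (m := n - 2) (sub_nonneg.2 hu1.le)
    (sub_le_self 1 hu0) (mul_pos hε hnpos) fun k hk => by
      have : (n : ℝ) ≤ k + 2 := by exact_mod_cast (by omega : n ≤ k + 2)
      linarith
  rw [sub_sub_cancel] at htail
  refine htail.trans ?_
  have hvar : (N : ℝ) * (1 - u) * u ≤ a * n / 4 := by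
    have : (1 - u) * u ≤ 1 / 4 := by nlinarith [sq_nonneg (u - 1 / 2)]
    have := mul_le_mul_of_nonneg_left this (Nat.cast_nonneg (α := ℝ) N)
    linarith
  calc
    _ ≤ a * n / 4 / (ε * n) ^ 2 := by gcongr
    _ = a / (4 * ε ^ 2 * n) := by field_simp
end
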